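/- Let n be a positive integer and h_1,…,h_n ∈ ℤ_{≥0} with H = h_1+⋯+h_n. Then for any ideals I_1,…,I_n (not necessarily differential) of A, the inclusion (I_1^{(h_1)}·I_2^{(h_2)}⋯I_n^{(h_n)})^{max_{1≤i≤n}(h_i+1)(H−h_i)+1} ⊆ (I_1·I_2⋯I_n)^{(H)} holds. -/

import Mathlib

/-- The entries of the upper triangular Toeplitz matrix attached to a sequence. -/
def toeplitzEntry {B : Type*} [CommRing B] (a : ℕ → B) (i j : ℕ) : B :=
  if i ≤ j then a (j - i) else 0

/-- The ideal generated by the `r × r` minors of the Toeplitz matrix of `a` whose columns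
are among the first `m` ones. -/
def toeplitzMinors {B : Type*} [CommRing B] (a : ℕ → B) (m r : ℕ) : Ideal B :=
  Ideal.span {x | ∃ ρ κ : Fin r → ℕ, (∀ i, κ i < m) ∧
    x = (Matrix.of fun i j => toeplitzEntry a (ρ i) (κ j)).det}

theorem map_toeplitzEntry {B C : Type*} [CommRing B] [CommRing C] (f : B →+* C) (a : ℕ → B)
    (i j : ℕ) : f (toeplitzEntry a i j) = toeplitzEntry (fun k => f (a k)) i j := by
  unfold toeplitzEntry; split_ifs <;> simp

theorem map_toeplitz_det {B C : Type*} [CommRing B] [CommRing C] (f : B →+* C) (a : ℕ → B)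
    {r : ℕ} (ρ κ : Fin r → ℕ) :
    f (Matrix.of fun i j => toeplitzEntry a (ρ i) (κ j)).det =
      (Matrix.of fun i j => toeplitzEntry (fun k => f (a k)) (ρ i) (κ j)).det := by
  rw [RingHom.map_det]
  congr 1
  ext i j
  simp [map_toeplitzEntry]

theorem map_mem_toeplitzMinors {B C : Type*} [CommRing B] [CommRing C] (f : B →+* C) (a : ℕ → B)
    (m r : ℕ) {x : B} (hx : x ∈ toeplitzMinors a m r) :
    f x ∈ toeplitzMinors (fun k => f (a k)) m r := by
  have h : toeplitzMinors a m r ≤ (toeplitzMinors (fun k => f (a k)) m r).comap f := by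
    refine Ideal.span_le.2 ?_
    rintro _ ⟨ρ, κ, hκ, rfl⟩
    exact Ideal.subset_span ⟨ρ, κ, hκ, map_toeplitz_det f a ρ κ⟩
  exact h hx

theorem toeplitzMinors_zero {B : Type*} [CommRing B] (a : ℕ → B) (m : ℕ) :
    toeplitzMinors a m 0 = ⊤ := by
  rw [Ideal.eq_top_iff_one]
  exact Ideal.subset_span ⟨Fin.elim0, Fin.elim0, fun i => i.elim0, by simp⟩

theorem mul_mem_toeplitzMinors {B : Type*} [CommRing B] (a : ℕ → B) (m r : ℕ) {x : B}
    (hx : x ∈ toeplitzMinors a m r) : a 0 * x ∈ toeplitzMinors a (m + 1) (r + 1) := by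
  have h : toeplitzMinors a m r ≤
      Submodule.comap (LinearMap.mulLeft B (a 0)) (toeplitzMinors a (m + 1) (r + 1)) := by
    refine Submodule.span_le.2 ?_
    rintro _ ⟨ρ, κ, hκ, rfl⟩
    refine Ideal.subset_span ⟨Fin.cons 0 fun i => ρ i + 1, Fin.cons 0 fun i => κ i + 1, ?_, ?_⟩
    · intro i
      refine Fin.cases ?_ (fun j => ?_) i
      · simp
      · simpa using hκ j
    · rw [Matrix.det_succ_column_zero, Fin.sum_univ_succ, Finset.sum_eq_zero]
      · simp [toeplitzEntry, Matrix.submatrix]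
      · intro i _
        simp [toeplitzEntry]
  exact h hx

theorem toeplitzMinors_shift_le {B : Type*} [CommRing B] (a : ℕ → B) (m r : ℕ) :
    toeplitzMinors (fun k => a (k + 1)) m r ≤
      toeplitzMinors a (m + 1) r ⊔ Ideal.span {a 0} := by
  refine Ideal.span_le.2 ?_
  rintro _ ⟨ρ, κ, hκ, rfl⟩
  set π := Ideal.Quotient.mk (Ideal.span {a 0})
  have h0 : π (a 0) = 0 := Ideal.Quotient.eq_zero_iff_mem.2 (Ideal.mem_span_singleton_self _)
  have h : π (Matrix.of fun i j => toeplitzEntry (fun k => a (k + 1)) (ρ i) (κ j)).det =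
      π (Matrix.of fun i j => toeplitzEntry a (ρ i) (κ j + 1)).det := by
    rw [map_toeplitz_det π, map_toeplitz_det π a ρ fun j => κ j + 1]
    congr 1
    ext i j
    simp only [toeplitzEntry, Matrix.of_apply]
    rcases lt_trichotomy (ρ i) (κ j + 1) with h | h | h
    · rw [if_pos (by omega), if_pos (by omega)]
      congr 2
      omega
    · rw [if_neg (by omega), if_pos (by omega), h, Nat.sub_self, h0]
    · rw [if_neg (by omega), if_neg (by omega)]
  have hmem : (Matrix.of fun i j => toeplitzEntry a (ρ i) (κ j + 1)).det ∈
      toeplitzMinors a (m + 1) r :=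
    Ideal.subset_span ⟨ρ, fun j => κ j + 1, fun i => Nat.succ_lt_succ (hκ i), rfl⟩
  simpa using Submodule.add_mem_sup hmem (Ideal.Quotient.eq.1 h)

/-- The bidegree of the variable `X k`: degree one and weight `k`. -/
def seqWeight (k : ℕ) : ℤ × ℤ := (1, k)

section

attribute [local instance] MvPolynomial.weightedGradedAlgebra

open MvPolynomial

theorem toeplitzMinors_isHomogeneous (m r : ℕ) :
    (toeplitzMinors (X : ℕ → MvPolynomial ℕ ℤ) m r).IsHomogeneous
      (weightedHomogeneousSubmodule ℤ seqWeight) := by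
  refine Ideal.homogeneous_span _ _ ?_
  rintro _ ⟨ρ, κ, hκ, rfl⟩
  refine ⟨∑ i, ((1 : ℤ), (κ i : ℤ) - ρ i), ?_⟩
  rw [Matrix.det_apply]
  refine Submodule.sum_mem _ fun σ _ => ?_
  refine Submodule.smul_of_tower_mem _ _ ?_
  rw [mem_weightedHomogeneousSubmodule]
  have hs : ∑ i, ((1 : ℤ), (κ i : ℤ) - ρ i) = ∑ i, ((1 : ℤ), (κ i : ℤ) - ρ (σ i)) := by
    ext
    · rw [Prod.fst_sum, Prod.fst_sum]
    · rw [Prod.snd_sum, Prod.snd_sum, Finset.sum_sub_distrib, Finset.sum_sub_distrib,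
        Equiv.sum_comp σ fun i => (ρ i : ℤ)]
  rw [hs]
  refine IsWeightedHomogeneous.prod _ _ _ fun i _ => ?_
  simp only [Matrix.of_apply, toeplitzEntry]
  split_ifs with h
  · have := isWeightedHomogeneous_X ℤ seqWeight (κ i - ρ (σ i))
    rwa [seqWeight, Nat.cast_sub h] at this
  · exact isWeightedHomogeneous_zero _ _ _

theorem seqWeight_nonneg (e : ℕ →₀ ℕ) : 0 ≤ Finsupp.weight seqWeight e := by
  rw [Finsupp.weight_apply]
  refine Finset.sum_nonneg fun k _ => nsmul_nonneg ?_ _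
  exact ⟨zero_le_one, Int.natCast_nonneg k⟩

theorem seqWeight_mapDomain_succ (e : ℕ →₀ ℕ) :
    Finsupp.weight seqWeight (e.mapDomain Nat.succ) =
      Finsupp.weight seqWeight e + (0, (Finsupp.weight seqWeight e).1) := by
  induction e using Finsupp.induction_linear with
  | zero =>
    simp
    rfl
  | add f g hf hg =>
    rw [Finsupp.mapDomain_add, map_add, map_add, hf, hg]
    ext
    · simp
    · simp
      ring
  | single k c =>
    rw [Finsupp.mapDomain_single, Finsupp.weight_single, Finsupp.weight_single]
    ext
    · simp [seqWeight]
    · simp [seqWeight]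
      ring

theorem exists_isWeightedHomogeneous_of_mem_sup {I : Ideal (MvPolynomial ℕ ℤ)}
    (hI : I.IsHomogeneous (weightedHomogeneousSubmodule ℤ seqWeight)) {x : MvPolynomial ℕ ℤ}
    {d w : ℤ} (hx : IsWeightedHomogeneous seqWeight x (d, w)) (h : x ∈ I ⊔ Ideal.span {X 0}) :
    ∃ y ∈ I, ∃ z, IsWeightedHomogeneous seqWeight z (d - 1, w) ∧ x = y + X 0 * z := by
  obtain ⟨y, hy, z, hz, rfl⟩ := Submodule.mem_sup.1 h
  obtain ⟨z, rfl⟩ := Ideal.mem_span_singleton'.1 hz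
  refine ⟨_, weightedHomogeneousComponent_mem_of_mem ℤ seqWeight hI hy (d, w), _,
    weightedHomogeneousComponent_isWeightedHomogeneous (d - 1, w) z, ?_⟩
  have h0 : X 0 ∈ weightedHomogeneousSubmodule ℤ seqWeight (1, 0) := by
    simpa [seqWeight] using isWeightedHomogeneous_X ℤ seqWeight 0
  have h1 := DirectSum.coe_decompose_mul_add_of_left_mem
    (weightedHomogeneousSubmodule ℤ seqWeight) (j := (d - 1, w)) (b := z) h0
  have h2 : ∀ (u : MvPolynomial ℕ ℤ) i, (DirectSum.decompose
      (weightedHomogeneousSubmodule ℤ seqWeight) u i : MvPolynomial ℕ ℤ) =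
      weightedHomogeneousComponent seqWeight i u :=
    weightedDecomposition.decompose'_apply ℤ seqWeight
  rw [h2, h2] at h1
  rw [← h1]
  conv_lhs => rw [← hx.weightedHomogeneousComponent_same]
  rw [map_add, mul_comm z]
  simp

theorem mem_toeplitzMinors_of_isWeightedHomogeneous (m : ℕ) :
    ∀ (p r : ℕ), p + r = m + 1 → ∀ (d w : ℤ), w + p * r < p * (d + 1) →
      ∀ x : MvPolynomial ℕ ℤ, IsWeightedHomogeneous seqWeight x (d, w) →
        x ∈ toeplitzMinors (X : ℕ → MvPolynomial ℕ ℤ) m r := by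
  induction m with
  | zero =>
    intro p r hpr d w hw x hx
    rcases Nat.eq_zero_or_pos r with rfl | hr
    · simp [toeplitzMinors_zero]
    obtain rfl : p = 0 := by omega
    rw [← support_sum_monomial_coeff x]
    refine Ideal.sum_mem _ fun e he => ?_
    have he' := hx (mem_support_iff.1 he)
    have := seqWeight_nonneg e
    rw [he'] at this
    have := this.2
    simp at hw this
    omega
  | succ m ih =>
    intro p r hpr d w hw x hx
    rcases r with _ | r
    · simp [toeplitzMinors_zero]
    rw [← support_sum_monomial_coeff x]
    refine Ideal.sum_mem _ fun e he => ?_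
    have he' := hx (mem_support_iff.1 he)
    have hnn := seqWeight_nonneg e
    rw [he'] at hnn
    have hw0 : 0 ≤ w := hnn.2
    rcases p with _ | p
    · simp at hw
      omega
    push_cast at hw
    have hX0 : ∀ z : MvPolynomial ℕ ℤ, IsWeightedHomogeneous seqWeight z (d - 1, w) →
        X 0 * z ∈ toeplitzMinors (X : ℕ → MvPolynomial ℕ ℤ) (m + 1) (r + 1) := fun z hz =>
      mul_mem_toeplitzMinors _ _ _
        (ih (p + 1) r (by omega) (d - 1) w (by push_cast; linarith) z hz)
    rcases Nat.eq_zero_or_pos (e 0) with h0 | h0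
    · have hsucc : (e.comapDomain Nat.succ Nat.succ_injective.injOn).mapDomain Nat.succ = e := by
        refine Finsupp.mapDomain_comapDomain _ Nat.succ_injective _ fun k hk => ?_
        rcases k with _ | k
        · simp [h0] at hk
        · exact ⟨k, rfl⟩
      set e' := e.comapDomain Nat.succ Nat.succ_injective.injOn
      have hwt := seqWeight_mapDomain_succ e'
      rw [hsucc, he'] at hwt
      have hwt' : Finsupp.weight seqWeight e' = (d, w - d) := by
        have h1 := congrArg Prod.fst hwt
        have h2 := congrArg Prod.snd hwt
        simp at h1 h2
        ext
        · exact h1.symm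
        · simp only [h2, h1]
          ring
      have hmem := ih p (r + 1) (by omega) d (w - d) (by push_cast; linarith)
        (monomial e' (coeff e x)) (isWeightedHomogeneous_monomial _ _ _ hwt')
      have hmem' := map_mem_toeplitzMinors (rename Nat.succ : _ →ₐ[ℤ] _).toRingHom _ _ _ hmem
      simp only [AlgHom.toRingHom_eq_coe, RingHom.coe_coe, rename_monomial, hsucc, rename_X]
        at hmem'
      obtain ⟨y, hy, z, hz, hyz⟩ := exists_isWeightedHomogeneous_of_mem_sup
        (toeplitzMinors_isHomogeneous _ _) (isWeightedHomogeneous_monomial _ _ _ he')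
        (toeplitzMinors_shift_le X m (r + 1) hmem')
      rw [hyz]
      exact Ideal.add_mem _ hy (hX0 z hz)
    · have hs : e = Finsupp.single 0 1 + (e - Finsupp.single 0 1) := by
        rw [add_tsub_cancel_of_le]
        simpa using Nat.succ_le_of_lt h0
      have hm : monomial e (coeff e x) =
          X 0 * monomial (e - Finsupp.single 0 1) (coeff e x) := by
        conv_lhs => rw [hs]
        rw [X, monomial_mul, one_mul, ← hs]
      rw [hm]
      refine hX0 _ (isWeightedHomogeneous_monomial _ _ _ ?_)
      rw [hs, map_add, Finsupp.weight_single] at he'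
      have h1 := congrArg Prod.fst he'
      have h2 := congrArg Prod.snd he'
      simp [seqWeight] at h1 h2
      ext
      · change _ = d - 1
        linarith
      · exact h2

end

theorem pow_mem_toeplitzMinors {B : Type*} [CommRing B] (a : ℕ → B) (h r : ℕ) :
    a h ^ ((h + 1) * r + 1) ∈ toeplitzMinors a (h + r + 1) (r + 1) := by
  set N := (h + 1) * r + 1 with hN
  have hhom : MvPolynomial.IsWeightedHomogeneous seqWeight
      (MvPolynomial.X h ^ N : MvPolynomial ℕ ℤ) ((N : ℤ), (N : ℤ) * h) := by
    convert (MvPolynomial.isWeightedHomogeneous_X ℤ seqWeight h).pow N using 1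
    ext <;> simp [seqWeight]
  have hX := mem_toeplitzMinors_of_isWeightedHomogeneous (h + r + 1) (h + 1) (r + 1) (by omega)
    _ _ (by push_cast [hN]; linarith) _ hhom
  have := map_mem_toeplitzMinors (MvPolynomial.aeval a : _ →ₐ[ℤ] B).toRingHom _ _ _ hX
  simpa using this

section NewtonTree

open Polynomial

variable {ι R : Type*} [CommRing R]

/-- The polynomial `∏_{k < m} (X - z k)`. -/
noncomputable def nodal (z : ℕ → R) (m : ℕ) : R[X] := ∏ k ∈ Finset.range m, (X - C (z k))

theorem nodal_monic (z : ℕ → R) (m : ℕ) : (nodal z m).Monic :=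
  monic_prod_of_monic _ _ fun k _ => monic_X_sub_C (z k)

/-- The ideal generated by the coefficients of the remainder of `∏ i, a i` modulo `nodal z m`. -/
noncomputable def remIdeal [Fintype ι] (z : ℕ → R) (a : ι → R[X]) (m : ℕ) : Ideal R :=
  Ideal.span (Set.range fun k => ((∏ i, a i) %ₘ nodal z m).coeff k)

theorem remIdeal_le_ker_iff [Fintype ι] {S : Type*} [CommRing S] (z : ℕ → R) (a : ι → R[X]) (m : ℕ)
    (φ : R →+* S) :
    remIdeal z a m ≤ RingHom.ker φ ↔ (nodal z m).map φ ∣ (∏ i, a i).map φ := by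
  rw [← modByMonic_eq_zero_iff_dvd ((nodal_monic z m).map φ),
    ← map_modByMonic _ (nodal_monic z m), remIdeal, Ideal.span_le, Polynomial.ext_iff]
  simp [Set.range_subset_iff, RingHom.mem_ker]

variable [DecidableEq ι]

/-- The family obtained from `a` by successive division: reading the word from its end, the
`k`-th letter `s` divides the `s`-th polynomial by `X - C (z k)`. -/
noncomputable def nodeQuot (z : ℕ → R) (a : ι → R[X]) : List ι → ι → R[X]
  | [] => a
  | s :: u => Function.update (nodeQuot z a u) s (nodeQuot z a u s /ₘ (X - C (z u.length)))

/-- The ideal generated by the remainders of the successive divisions in `nodeQuot`. -/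
noncomputable def nodeIdeal (z : ℕ → R) (a : ι → R[X]) : List ι → Ideal R
  | [] => ⊥
  | s :: u => nodeIdeal z a u ⊔ Ideal.span {(nodeQuot z a u s).eval (z u.length)}

/-- The product of the divisors which a word assigns to each index. -/
noncomputable def nodeDiv (z : ℕ → R) : List ι → ι → R[X]
  | [] => 1
  | s :: u => Function.update (nodeDiv z u) s ((X - C (z u.length)) * nodeDiv z u s)

theorem nodeDiv_monic (z : ℕ → R) (u : List ι) (i : ι) : (nodeDiv z u i).Monic := by
  induction u with
  | nil => exact monic_one
  | cons s u ih =>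
    by_cases h : i = s
    · subst h
      simpa [nodeDiv] using (monic_X_sub_C _).mul ih
    · simpa [nodeDiv, h] using ih

theorem natDegree_nodeDiv [Nontrivial R] (z : ℕ → R) (u : List ι) (i : ι) :
    (nodeDiv z u i).natDegree = u.count i := by
  induction u with
  | nil => simp [nodeDiv]
  | cons s u ih =>
    by_cases h : i = s
    · subst h
      simp [nodeDiv, (monic_X_sub_C (z u.length)).natDegree_mul (nodeDiv_monic z u i), ih,
        add_comm]
    · simp [nodeDiv, h, ih, List.count_cons_of_ne (Ne.symm h)]

theorem prod_nodeDiv [Fintype ι] (z : ℕ → R) (u : List ι) :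
    ∏ i, nodeDiv z u i = nodal z u.length := by
  induction u with
  | nil => simp [nodeDiv, nodal]
  | cons s u ih =>
    rw [nodeDiv, Finset.prod_update_of_mem (Finset.mem_univ s), mul_assoc, List.length_cons,
      nodal, Finset.prod_range_succ, ← nodal, ← ih, mul_comm]
    congr 1
    rw [← Finset.mul_prod_erase _ _ (Finset.mem_univ s), Finset.sdiff_singleton_eq_erase]

theorem nodeDiv_dvd_of_suffix (z : ℕ → R) {u w : List ι} (h : u <:+ w) (i : ι) :
    nodeDiv z u i ∣ nodeDiv z w i := by
  obtain ⟨v, rfl⟩ := h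
  induction v with
  | nil => exact dvd_rfl
  | cons s v ih =>
    refine ih.trans ?_
    by_cases h : i = s
    · subst h
      simp [nodeDiv]
    · simp [nodeDiv, h]

theorem nodeIdeal_le_of_suffix (z : ℕ → R) (a : ι → R[X]) {u w : List ι} (h : u <:+ w) :
    nodeIdeal z a u ≤ nodeIdeal z a w := by
  obtain ⟨v, rfl⟩ := h
  induction v with
  | nil => exact le_rfl
  | cons s v ih => exact ih.trans le_sup_left

theorem map_eq_nodeDiv_mul_nodeQuot {S : Type*} [CommRing S] (z : ℕ → R) (a : ι → R[X])
    (φ : R →+* S) (u : List ι) (h : nodeIdeal z a u ≤ RingHom.ker φ) (i : ι) :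
    (a i).map φ = (nodeDiv z u i).map φ * (nodeQuot z a u i).map φ := by
  induction u with
  | nil => simp [nodeDiv, nodeQuot]
  | cons s u ih =>
    rw [ih (le_sup_left.trans h)]
    by_cases hi : i = s
    · subst hi
      have h0 : φ ((nodeQuot z a u i).eval (z u.length)) = 0 :=
        h (Ideal.mem_sup_right (Ideal.mem_span_singleton_self _))
      have h1 := congrArg (Polynomial.map φ)
        (modByMonic_add_div (nodeQuot z a u i) (X - C (z u.length)))
      rw [modByMonic_X_sub_C_eq_C_eval, Polynomial.map_add, map_C, h0, C_0, zero_add] at h1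
      simp only [nodeDiv, nodeQuot, Function.update_self, ← h1, Polynomial.map_mul]
      ring
    · simp [nodeDiv, nodeQuot, hi]

variable [Fintype ι]

theorem remIdeal_le_nodeIdeal (z : ℕ → R) (a : ι → R[X]) (w : List ι) :
    remIdeal z a w.length ≤ nodeIdeal z a w := by
  rw [← Ideal.mk_ker (I := nodeIdeal z a w), remIdeal_le_ker_iff, Polynomial.map_prod,
    Finset.prod_congr rfl fun i _ => map_eq_nodeDiv_mul_nodeQuot z a _ w (Ideal.mk_ker).ge i,
    Finset.prod_mul_distrib, ← Polynomial.map_prod, prod_nodeDiv]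
  exact dvd_mul_right _ _

theorem prod_eval_mem_nodeIdeal_sup (z : ℕ → R) (a : ι → R[X]) (u : List ι) {m : ℕ}
    (hm : u.length < m) :
    ∏ i, (nodeQuot z a u i).eval (z u.length) ∈ nodeIdeal z a u ⊔ remIdeal z a m := by
  set P := nodeIdeal z a u ⊔ remIdeal z a m
  set φ := Ideal.Quotient.mk P
  have hker : RingHom.ker φ = P := Ideal.mk_ker
  obtain ⟨q, hq⟩ := (remIdeal_le_ker_iff z a m φ).1 (le_sup_right.trans hker.ge)
  obtain ⟨E, hE⟩ : nodal z (u.length + 1) ∣ nodal z m :=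
    Finset.prod_dvd_prod_of_subset _ _ _ (Finset.range_subset_range.2 hm)
  rw [Polynomial.map_prod, Finset.prod_congr rfl fun i _ => map_eq_nodeDiv_mul_nodeQuot z a φ u
    (le_sup_left.trans hker.ge) i, Finset.prod_mul_distrib, ← Polynomial.map_prod, prod_nodeDiv, hE,
    nodal, nodal, Finset.prod_range_succ, ← nodal, Polynomial.map_mul, Polynomial.map_mul,
    mul_assoc, mul_assoc] at hq
  have hq' := ((nodal_monic z u.length).map φ).isRegular.left hq
  rw [← hker, RingHom.mem_ker, map_prod]
  have h := congrArg (Polynomial.eval (φ (z u.length))) hq'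
  simpa [eval_prod, eval_map_apply] using h

/-- If the ideals attached to the words of length `m` are prime and the remainders of
the competing letters are nonzero modulo them, then an element of all these ideals lies in the
ideal generated by the remainder of the product. -/
theorem mem_nodeIdeal_sup_remIdeal (z : ℕ → R) (a : ι → R[X]) (m : ℕ)
    (hprime : ∀ w : List ι, w.length = m → (nodeIdeal z a w).IsPrime)
    (hne : ∀ w : List ι, w.length = m → ∀ s u, s :: u <:+ w → ∀ i, i ≠ s →
      (nodeQuot z a u i).eval (z u.length) ∉ nodeIdeal z a w) (l : ℕ) :
    ∀ u : List ι, u.length + l = m → ∀ x : R,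
      (∀ w : List ι, w.length = m → u <:+ w → x ∈ nodeIdeal z a w) →
        x ∈ nodeIdeal z a u ⊔ remIdeal z a m := by
  induction l with
  | zero => exact fun u hu x hx => Ideal.mem_sup_left (hx u hu List.suffix_rfl)
  | succ l ih =>
    intro u hu x hx
    set c : ι → R := fun i => (nodeQuot z a u i).eval (z u.length) with hc
    have key : ∀ T : Finset ι, ∃ y, x - (∏ i ∈ T, c i) * y ∈ nodeIdeal z a u ⊔ remIdeal z a m ∧
        ∀ s ∉ T, ∀ w : List ι, w.length = m → s :: u <:+ w → y ∈ nodeIdeal z a w := by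
      intro T
      induction T using Finset.induction_on with
      | empty =>
        exact ⟨x, by simp, fun s _ w hw hs => hx w hw ((List.suffix_cons s u).trans hs)⟩
      | insert s T hsT ihT =>
        obtain ⟨y, hy, hyw⟩ := ihT
        have h1 := ih (s :: u) (by simp; omega) y (hyw s hsT)
        rw [nodeIdeal, sup_right_comm] at h1
        obtain ⟨p, hp, q, hq, rfl⟩ := Submodule.mem_sup.1 h1
        obtain ⟨q, rfl⟩ := Ideal.mem_span_singleton'.1 hq
        refine ⟨q, ?_, fun t ht w hw hs => ?_⟩
        · rw [Finset.prod_insert hsT]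
          convert Ideal.add_mem _ hy (Ideal.mul_mem_left _ (∏ i ∈ T, c i) hp) using 1
          ring
        · simp only [Finset.mem_insert, not_or] at ht
          have hpw : p ∈ nodeIdeal z a w :=
            (sup_le (nodeIdeal_le_of_suffix z a ((List.suffix_cons t u).trans hs))
              (hw ▸ remIdeal_le_nodeIdeal z a w)) hp
          have h2 := (Ideal.add_mem_iff_right _ hpw).1 (hyw t ht.2 w hw hs)
          exact ((hprime w hw).mem_or_mem h2).resolve_right
            (hne w hw t u hs s (Ne.symm ht.1))
    obtain ⟨y, hy, -⟩ := key Finset.univ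
    have := Ideal.add_mem _ hy (Ideal.mul_mem_right y _
      (prod_eval_mem_nodeIdeal_sup z a u (m := m) (by omega)))
    rwa [sub_add_cancel] at this

end NewtonTree

section Generic

open Polynomial

/-- The polynomial with prescribed coefficients in degrees below `L`. -/
noncomputable def finPoly {R : Type*} [CommRing R] {L : ℕ} (f : Fin L → R) : R[X] :=
  ∑ k : Fin L, monomial (k : ℕ) (f k)

theorem coeff_finPoly {R : Type*} [CommRing R] {L : ℕ} (f : Fin L → R) (j : ℕ) :
    (finPoly f).coeff j = if h : j < L then f ⟨j, h⟩ else 0 := by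
  simp only [finPoly, finsetSum_coeff, coeff_monomial]
  split_ifs with h
  · rw [Finset.sum_eq_single ⟨j, h⟩]
    · simp
    · intro k _ hk
      exact if_neg fun hkj => hk (Fin.ext hkj)
    · simp
  · exact Finset.sum_eq_zero fun k _ => if_neg (by omega)

theorem map_finPoly {R S : Type*} [CommRing R] [CommRing S] {L : ℕ} (φ : R →+* S)
    (f : Fin L → R) : (finPoly f).map φ = finPoly fun k => φ (f k) := by
  simp [finPoly, Polynomial.map_sum]

theorem finPoly_coeff {R : Type*} [CommRing R] {L : ℕ} {p : R[X]} (hp : p.natDegree < L) :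
    (finPoly fun k : Fin L => p.coeff k) = p := by
  ext j
  rw [coeff_finPoly]
  split_ifs with h
  · rfl
  · exact (coeff_eq_zero_of_natDegree_lt (by omega)).symm

variable {ι Λ : Type*} [CommRing Λ] {m : ℕ}

/-- The polynomials of degree at most `m` whose coefficients are indeterminates. -/
noncomputable def genPoly (ι Λ : Type*) [CommRing Λ] (m : ℕ) (i : ι) :
    (MvPolynomial (ι × Fin (m + 1)) Λ)[X] :=
  finPoly fun k => MvPolynomial.X (i, k)

/-- The substitution which replaces `genPoly ι Λ m` by `b`. -/
noncomputable def coeffSubst {S : Type*} [CommRing S] [Algebra Λ S] (m : ℕ) (b : ι → S[X]) :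
    MvPolynomial (ι × Fin (m + 1)) Λ →ₐ[Λ] S :=
  MvPolynomial.aeval fun p => (b p.1).coeff p.2

theorem map_coeffSubst_genPoly {S : Type*} [CommRing S] [Algebra Λ S] (b : ι → S[X]) {i : ι}
    (hb : (b i).natDegree ≤ m) :
    (genPoly ι Λ m i).map (coeffSubst m b : _ →ₐ[Λ] S).toRingHom = b i := by
  rw [genPoly, map_finPoly]
  simpa [coeffSubst] using finPoly_coeff (Nat.lt_succ_of_le hb)

theorem natDegree_genPoly_le (i : ι) : (genPoly ι Λ m i).natDegree ≤ m := by
  refine natDegree_le_iff_coeff_eq_zero.2 fun j hj => ?_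
  rw [genPoly, coeff_finPoly, dif_neg (by omega)]

variable [DecidableEq ι]

theorem map_nodeDiv {R S : Type*} [CommRing R] [CommRing S] (φ : R →+* S) (z : ℕ → R)
    (u : List ι) (i : ι) : (nodeDiv z u i).map φ = nodeDiv (fun k => φ (z k)) u i := by
  induction u with
  | nil => simp [nodeDiv]
  | cons s u ih =>
    by_cases h : i = s
    · subst h
      simp [nodeDiv, ih]
    · simp [nodeDiv, h, ih]

theorem natDegree_nodeQuot_le {R : Type*} [CommRing R] [Nontrivial R] (z : ℕ → R) (a : ι → R[X])
    (u : List ι) (i : ι) :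
    (nodeQuot z a u i).natDegree ≤ (a i).natDegree - u.count i := by
  induction u with
  | nil => simp [nodeQuot]
  | cons s u ih =>
    by_cases h : i = s
    · subst h
      simp only [nodeQuot, Function.update_self, List.count_cons_self,
        natDegree_divByMonic _ (monic_X_sub_C _), natDegree_X_sub_C]
      omega
    · simpa [nodeQuot, h, List.count_cons_of_ne (Ne.symm h)] using ih

theorem exists_nodeDiv_eq_mul {R : Type*} [CommRing R] [IsDomain R] {z : ℕ → R}
    (hz : Function.Injective z) (u v : List ι) {s i : ι} (hi : i ≠ s) :
    ∃ c, nodeDiv z (v ++ s :: u) i = nodeDiv z u i * c ∧ c.eval (z u.length) ≠ 0 := by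
  induction v with
  | nil => exact ⟨1, by simp [nodeDiv, hi], by simp⟩
  | cons t v ih =>
    obtain ⟨c, hc, hc0⟩ := ih
    by_cases h : i = t
    · subst h
      refine ⟨(X - C (z (v ++ s :: u).length)) * c, ?_, ?_⟩
      · simp only [List.cons_append, nodeDiv, Function.update_self, hc]
        ring
      · rw [eval_mul, eval_sub, eval_X, eval_C]
        refine mul_ne_zero (sub_ne_zero.2 fun h => ?_) hc0
        have := hz h
        simp at this
        omega
    · exact ⟨c, by simpa [nodeDiv, h] using hc, hc0⟩

/-- The general polynomials which together with the divisors of the word `w` parametrize the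
families with vanishing remainders along `w`. -/
noncomputable def cofactor (Λ : Type*) [CommRing Λ] (m : ℕ) (w : List ι) (i : ι) :
    (MvPolynomial (ι × Fin (m + 1)) Λ)[X] :=
  finPoly fun k => if (k : ℕ) + w.count i ≤ m then MvPolynomial.X (i, k) else 0

theorem natDegree_cofactor_le (w : List ι) (i : ι) :
    (cofactor Λ m w i).natDegree ≤ m - w.count i := by
  refine natDegree_le_iff_coeff_eq_zero.2 fun j hj => ?_
  rw [cofactor, coeff_finPoly]
  split_ifs with h1 h2
  · simp only at h2
    omega
  · rfl
  · rfl

theorem map_coeffSubst_cofactor {S : Type*} [CommRing S] [Algebra Λ S] (b : ι → S[X]) {i : ι}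
    (w : List ι) (hw : w.count i ≤ m) (hb : (b i).natDegree ≤ m - w.count i) :
    (cofactor Λ m w i).map (coeffSubst m b : _ →ₐ[Λ] S).toRingHom = b i := by
  rw [cofactor, map_finPoly]
  conv_rhs => rw [← finPoly_coeff (Nat.lt_succ_of_le (hb.trans (Nat.sub_le m _)))]
  congr 1
  ext k
  split_ifs with h
  · simp [coeffSubst]
  · rw [map_zero, coeff_eq_zero_of_natDegree_lt (by omega)]

theorem eval_cofactor_ne_zero [Nontrivial Λ] {w : List ι} {i : ι} (hw : w.count i ≤ m) (x : Λ) :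
    (cofactor Λ m w i).eval (MvPolynomial.C x) ≠ 0 := by
  intro h
  have h1 := congrArg (coeffSubst m (fun _ => 1) : _ →ₐ[Λ] Λ).toRingHom h
  rw [← eval_map_apply, map_coeffSubst_cofactor _ w hw (by simp)] at h1
  simp at h1

variable {ζ : ℕ → Λ}

/-- The parametrization of the families with vanishing remainders along `w`. -/
noncomputable def wordSubst (m : ℕ) (ζ : ℕ → Λ) (w : List ι) :
    MvPolynomial (ι × Fin (m + 1)) Λ →ₐ[Λ] MvPolynomial (ι × Fin (m + 1)) Λ :=
  coeffSubst m fun i => nodeDiv (fun k => MvPolynomial.C (ζ k)) w i * cofactor Λ m w i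

theorem map_wordSubst_genPoly [Nontrivial Λ] (ζ : ℕ → Λ) {w : List ι} (hw : w.length = m)
    (i : ι) : (genPoly ι Λ m i).map (wordSubst m ζ w).toRingHom =
      nodeDiv (fun k => MvPolynomial.C (ζ k)) w i * cofactor Λ m w i := by
  refine map_coeffSubst_genPoly _ (natDegree_mul_le.trans ?_)
  have h1 := natDegree_nodeDiv (fun k => (MvPolynomial.C (ζ k) : MvPolynomial (ι × Fin (m + 1)) Λ))
    w i
  have h2 := natDegree_cofactor_le (Λ := Λ) (m := m) w i
  have h3 := w.count_le_length (a := i)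
  omega

theorem map_wordSubst_nodeDiv (ζ : ℕ → Λ) (u w : List ι) (i : ι) :
    (nodeDiv (fun k => MvPolynomial.C (ζ k)) u i).map (wordSubst m ζ w).toRingHom =
      nodeDiv (fun k => MvPolynomial.C (ζ k)) u i := by
  rw [map_nodeDiv]
  congr 1
  ext1 k
  exact (wordSubst m ζ w).commutes (ζ k)

theorem nodeIdeal_le_ker_wordSubst [Nontrivial Λ] (ζ : ℕ → Λ) {w : List ι} (hw : w.length = m)
    (u : List ι) (hu : u <:+ w) :
    nodeIdeal (fun k => MvPolynomial.C (ζ k)) (genPoly ι Λ m) u ≤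
      RingHom.ker (wordSubst m ζ w).toRingHom := by
  induction u with
  | nil => exact bot_le
  | cons s u ih =>
    have ihu := ih ((List.suffix_cons s u).trans hu)
    refine sup_le ihu ?_
    rw [Ideal.span_singleton_le_iff_mem, RingHom.mem_ker]
    have h := map_eq_nodeDiv_mul_nodeQuot _ _ _ u ihu s
    rw [map_wordSubst_genPoly ζ hw, map_wordSubst_nodeDiv] at h
    obtain ⟨e, he⟩ := nodeDiv_dvd_of_suffix (fun k => MvPolynomial.C (ζ k)) hu s
    rw [he, nodeDiv, Function.update_self, mul_comm (X - _), mul_assoc, mul_assoc] at h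
    have h' := (nodeDiv_monic _ u s).isRegular.left h
    have h1 := congrArg (Polynomial.eval (MvPolynomial.C (ζ u.length))) h'
    have hC : (wordSubst m ζ w).toRingHom (MvPolynomial.C (ζ u.length)) =
      MvPolynomial.C (ζ u.length) := (wordSubst m ζ w).commutes _
    rw [← eval_map_apply, hC, ← h1]
    simp

theorem nodeIdeal_eq_ker_wordSubst [Nontrivial Λ] (ζ : ℕ → Λ) {w : List ι} (hw : w.length = m) :
    nodeIdeal (fun k => MvPolynomial.C (ζ k)) (genPoly ι Λ m) w =
      RingHom.ker (wordSubst m ζ w).toRingHom := by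
  refine le_antisymm (nodeIdeal_le_ker_wordSubst ζ hw w List.suffix_rfl) fun x hx => ?_
  set P := nodeIdeal (fun k => MvPolynomial.C (ζ k)) (genPoly ι Λ m) w
  set θ : _ →ₐ[Λ] MvPolynomial (ι × Fin (m + 1)) Λ :=
    coeffSubst m (nodeQuot (fun k => MvPolynomial.C (ζ k)) (genPoly ι Λ m) w) with hθ
  have key : ((Ideal.Quotient.mkₐ Λ P).comp θ).comp (wordSubst m ζ w) =
      Ideal.Quotient.mkₐ Λ P := by
    refine MvPolynomial.algHom_ext fun ⟨i, k⟩ => ?_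
    have hX : (MvPolynomial.X (i, k) : MvPolynomial (ι × Fin (m + 1)) Λ) =
        (genPoly ι Λ m i).coeff k := by
      rw [genPoly, coeff_finPoly, dif_pos k.2]
    have hcount := w.count_le_length (a := i)
    have h1 : (((genPoly ι Λ m i).map (wordSubst m ζ w).toRingHom).map θ.toRingHom).map
        (Ideal.Quotient.mk P) = (genPoly ι Λ m i).map (Ideal.Quotient.mk P) := by
      rw [map_eq_nodeDiv_mul_nodeQuot _ _ _ w (Ideal.mk_ker).ge i, map_wordSubst_genPoly ζ hw,
        Polynomial.map_mul, hθ, map_coeffSubst_cofactor _ w (by omega), Polynomial.map_mul,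
        map_nodeDiv]
      · congr 3
        ext1 k
        exact θ.commutes _
      · refine (natDegree_nodeQuot_le _ _ _ _).trans ?_
        have := natDegree_genPoly_le (Λ := Λ) (m := m) i
        omega
    have h2 := congrArg (fun p => Polynomial.coeff p k) h1
    simp only [coeff_map] at h2
    rw [← hX] at h2
    exact h2
  have h := DFunLike.congr_fun key x
  have hx0 : wordSubst m ζ w x = 0 := hx
  simp only [AlgHom.comp_apply, hx0, map_zero] at h
  exact Ideal.Quotient.eq_zero_iff_mem.1 h.symm

theorem mem_remIdeal_genPoly [Fintype ι] [IsDomain Λ] (hζ : Function.Injective ζ)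
    {x : MvPolynomial (ι × Fin (m + 1)) Λ}
    (hx : ∀ w : List ι, w.length = m →
      x ∈ nodeIdeal (fun k => MvPolynomial.C (ζ k)) (genPoly ι Λ m) w) :
    x ∈ remIdeal (fun k => MvPolynomial.C (ζ k)) (genPoly ι Λ m) m := by
  have h := mem_nodeIdeal_sup_remIdeal (fun k => MvPolynomial.C (ζ k)) (genPoly ι Λ m) m
    (fun w hw => ?_) (fun w hw s u hu i hi hmem => ?_) m [] (by simp) x fun w hw _ => hx w hw
  · simpa [nodeIdeal] using h
  · rw [nodeIdeal_eq_ker_wordSubst ζ hw]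
    exact RingHom.ker_isPrime _
  · rw [nodeIdeal_eq_ker_wordSubst ζ hw, RingHom.mem_ker] at hmem
    have hle := nodeIdeal_le_ker_wordSubst ζ hw u ((List.suffix_cons s u).trans hu)
    have h := map_eq_nodeDiv_mul_nodeQuot _ _ _ u hle i
    rw [map_wordSubst_genPoly ζ hw, map_wordSubst_nodeDiv] at h
    obtain ⟨v, rfl⟩ := hu
    have hinj : Function.Injective fun k =>
        (MvPolynomial.C (ζ k) : MvPolynomial (ι × Fin (m + 1)) Λ) :=
      (MvPolynomial.C_injective _ _).comp hζ
    obtain ⟨c, hc, hc0⟩ := exists_nodeDiv_eq_mul hinj u v hi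
    rw [hc, mul_assoc] at h
    have h1 := congrArg (Polynomial.eval (MvPolynomial.C (ζ u.length)))
      ((nodeDiv_monic _ u i).isRegular.left h)
    have hC : (wordSubst m ζ (v ++ s :: u)).toRingHom (MvPolynomial.C (ζ u.length)) =
      MvPolynomial.C (ζ u.length) := (wordSubst m ζ _).commutes _
    rw [← eval_map_apply, hC, ← h1, eval_mul] at hmem
    refine mul_ne_zero hc0 (eval_cofactor_ne_zero ?_ _) hmem
    exact hw ▸ List.count_le_length

end Generic

section Minors

open Polynomial

theorem mul_modByMonic_mul {S : Type*} [CommRing S] [Nontrivial S] {d c : S[X]} (hd : d.Monic)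
    (hc : c.Monic) (p : S[X]) : (d * p) %ₘ (d * c) = d * (p %ₘ c) := by
  refine (div_modByMonic_unique (p /ₘ c) _ (hd.mul hc) ⟨?_, ?_⟩).2
  · conv_rhs => rw [← modByMonic_add_div p c]
    ring
  · rw [hd.degree_mul_comm, hd.degree_mul_comm, hd.degree_mul, hd.degree_mul]
    exact WithBot.add_lt_add_right (degree_ne_bot.2 hd.ne_zero) (degree_modByMonic_lt p hc)

theorem det_coeff_mul_eq_zero {S : Type*} [CommRing S] (d : S[X]) {r N : ℕ} (hN : N < r)
    (q : Fin r → S[X]) (hq : ∀ i, (q i).degree < N) (κ : Fin r → ℕ) :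
    (Matrix.of fun i j => (d * q i).coeff (κ j)).det = 0 := by
  have h : (Matrix.of fun i j => (d * q i).coeff (κ j)) =
      (Matrix.of fun i (k : Fin r) => (q i).coeff k) *
        Matrix.of fun (k : Fin r) j => (d * X ^ (k : ℕ)).coeff (κ j) := by
    ext i j
    have hqi : q i = ∑ k : Fin r, C ((q i).coeff k) * X ^ (k : ℕ) := by
      rw [Fin.sum_univ_eq_sum_range (fun k => C ((q i).coeff k) * X ^ k) r]
      refine as_sum_range_C_mul_X_pow' _ ?_
      rcases eq_or_ne (q i) 0 with h0 | h0
      · rw [h0, natDegree_zero]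
        omega
      · exact ((natDegree_lt_iff_degree_lt h0).2 (hq i)).trans hN
    rw [Matrix.of_apply, Matrix.mul_apply]
    conv_lhs => rw [hqi]
    rw [Finset.mul_sum, finsetSum_coeff]
    refine Finset.sum_congr rfl fun k _ => ?_
    rw [mul_left_comm, coeff_C_mul]
    rfl
  rw [h, Matrix.det_mul, Matrix.det_eq_zero_of_column_eq_zero ⟨N, hN⟩, zero_mul]
  intro i
  exact coeff_eq_zero_of_degree_lt (hq i)

variable {ι : Type*} [Fintype ι] [DecidableEq ι]

/-- The entries of the matrices whose rows are the remainders of the polynomials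
`X ^ k * p` modulo `nodal z m`. -/
noncomputable def remEntry {R : Type*} [CommRing R] (z : ℕ → R) (m : ℕ) (p : R[X]) (k j : ℕ) : R :=
  ((X ^ k * p) %ₘ nodal z m).coeff j

theorem natDegree_nodal {R : Type*} [CommRing R] [Nontrivial R] (z : ℕ → R) (m : ℕ) :
    (nodal z m).natDegree = m := by
  rw [nodal, natDegree_prod_of_monic _ _ fun k _ => monic_X_sub_C (z k)]
  simp

theorem prod_det_remEntry_mem_nodeIdeal {R : Type*} [CommRing R] (z : ℕ → R) (a : ι → R[X])
    (w : List ι) (h : ι → ℕ) (hh : ∑ i, h i < w.length)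
    (ρ κ : ∀ i, Fin (w.length - h i) → ℕ) :
    ∏ i, (Matrix.of fun k j => remEntry z w.length (a i) (ρ i k) (κ i j)).det ∈
      nodeIdeal z a w := by
  set P := nodeIdeal z a w with hP
  set φ := Ideal.Quotient.mk P
  have hker : RingHom.ker φ = P := Ideal.mk_ker
  rcases subsingleton_or_nontrivial (R ⧸ P) with hs | hs
  · rw [Ideal.Quotient.subsingleton_iff.1 hs]
    trivial
  have : Nontrivial R := φ.domain_nontrivial
  obtain ⟨i, hi⟩ : ∃ i, h i < w.count i := by
    by_contra! hcon
    have h1 : ∑ i, w.count i = w.length := by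
      rw [← natDegree_nodal z w.length, ← prod_nodeDiv,
        natDegree_prod_of_monic _ _ fun i _ => nodeDiv_monic z w i]
      exact Finset.sum_congr rfl fun i _ => (natDegree_nodeDiv z w i).symm
    have h2 := Finset.sum_le_sum fun i (_ : i ∈ Finset.univ) => hcon i
    omega
  refine Ideal.mem_of_dvd _ (Finset.dvd_prod_of_mem _ (Finset.mem_univ i)) ?_
  rw [← hker, RingHom.mem_ker, RingHom.map_det]
  set c := ∏ j ∈ Finset.univ.erase i, nodeDiv z w j with hc
  have hcm : c.Monic := monic_prod_of_monic _ _ fun j _ => nodeDiv_monic z w j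
  have hmul : nodal z w.length = nodeDiv z w i * c := by
    rw [hc, Finset.mul_prod_erase _ _ (Finset.mem_univ i), prod_nodeDiv]
  have hdeg : c.natDegree < w.length - h i := by
    have h1 := congrArg natDegree hmul
    rw [(nodeDiv_monic z w i).natDegree_mul hcm, natDegree_nodal, natDegree_nodeDiv] at h1
    omega
  rw [← det_coeff_mul_eq_zero ((nodeDiv z w i).map φ) hdeg
    (fun k => (X ^ ρ i k * (nodeQuot z a w i).map φ) %ₘ c.map φ) (fun k => ?_) (κ i)]
  · congr 1
    ext k j
    simp only [RingHom.mapMatrix_apply, Matrix.map_apply, Matrix.of_apply, remEntry]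
    rw [← coeff_map, map_modByMonic _ (nodal_monic z _), hmul, Polynomial.map_mul,
      Polynomial.map_mul, Polynomial.map_pow, map_X,
      map_eq_nodeDiv_mul_nodeQuot z a φ w hker.ge i, mul_left_comm,
      mul_modByMonic_mul ((nodeDiv_monic z w i).map φ) (hcm.map φ)]
  · rw [← hcm.natDegree_map φ, ← degree_eq_natDegree (hcm.map φ).ne_zero]
    exact degree_modByMonic_lt _ (hcm.map φ)

theorem coeff_modByMonic_X_pow {S : Type*} [CommRing S] (p : S[X]) {m j : ℕ} (hj : j < m) :
    (p %ₘ X ^ m).coeff j = p.coeff j := by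
  conv_rhs => rw [← modByMonic_add_div p (X ^ m)]
  rw [coeff_add, coeff_X_pow_mul', if_neg (by omega), add_zero]

theorem prod_toeplitzMinors_le {B : Type*} [CommRing B] (b : ι → ℕ → B) (h : ι → ℕ) (m : ℕ)
    (hh : ∑ i, h i < m) (J : Ideal B)
    (hJ : ∀ k < m, (∏ i, finPoly fun j : Fin (m + 1) => b i j).coeff k ∈ J) :
    ∏ i, toeplitzMinors (b i) m (m - h i) ≤ J := by
  unfold toeplitzMinors
  rw [Ideal.prod_span, Ideal.span_le]
  intro x hx
  obtain ⟨g, hg, rfl⟩ := (Set.mem_finsetProd _ _ _).1 hx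
  have hg' : ∀ i, ∃ ρ κ : Fin (m - h i) → ℕ, (∀ k, κ k < m) ∧
    g i = (Matrix.of fun k j => toeplitzEntry (b i) (ρ k) (κ j)).det :=
      fun i => hg (Finset.mem_univ i)
  choose ρ κ hκ hdet using hg'
  set ζ : ℕ → MvPolynomial ℕ ℤ := MvPolynomial.X
  set Φ : MvPolynomial (ι × Fin (m + 1)) (MvPolynomial ℕ ℤ) →+* B :=
    MvPolynomial.eval₂Hom (MvPolynomial.aeval fun _ => (0 : B) : _ →ₐ[ℤ] B).toRingHom
      fun p => b p.1 p.2 with hΦ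
  have hgen : ∀ i, (genPoly ι (MvPolynomial ℕ ℤ) m i).map Φ =
      finPoly fun j : Fin (m + 1) => b i j := by
    intro i
    rw [genPoly, map_finPoly]
    simp [hΦ]
  have hnodal : (nodal (fun k => MvPolynomial.C (ζ k)) m).map Φ = X ^ m := by
    simp [nodal, Polynomial.map_prod, hΦ, ζ]
  have hmem := mem_remIdeal_genPoly (m := m) (MvPolynomial.X_injective : Function.Injective ζ)
    (x := ∏ i, (Matrix.of fun k j => remEntry (fun k => MvPolynomial.C (ζ k)) m
      (genPoly ι (MvPolynomial ℕ ℤ) m i) (ρ i k) (κ i j)).det) fun w hw => by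
        subst hw
        exact prod_det_remEntry_mem_nodeIdeal _ _ w h hh ρ κ
  have hle := (remIdeal_le_ker_iff (fun k => MvPolynomial.C (ζ k)) (genPoly ι _ m) m
    ((Ideal.Quotient.mk J).comp Φ)).2 (by
      rw [← Polynomial.map_map, ← Polynomial.map_map, hnodal, Polynomial.map_prod,
        Finset.prod_congr rfl fun i _ => hgen i, Polynomial.map_pow, map_X, X_pow_dvd_iff]
      intro k hk
      rw [coeff_map]
      exact Ideal.Quotient.eq_zero_iff_mem.2 (hJ k hk))
  have h0 : Φ _ ∈ J := Ideal.Quotient.eq_zero_iff_mem.1 (hle hmem)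
  rw [map_prod] at h0
  refine (congrArg (· ∈ J) (Finset.prod_congr rfl fun i _ => ?_)).mpr h0
  rw [hdet, RingHom.map_det]
  congr 1
  ext k j
  simp only [RingHom.mapMatrix_apply, Matrix.map_apply, Matrix.of_apply, remEntry]
  rw [← coeff_map, map_modByMonic _ (nodal_monic _ _), hnodal, coeff_modByMonic_X_pow _ (hκ i j),
    Polynomial.map_mul, hgen, Polynomial.map_pow, map_X, coeff_X_pow_mul', toeplitzEntry]
  split_ifs with hij
  · rw [coeff_finPoly, dif_pos]
    have := hκ i j
    omega
  · rfl

/-- If the coefficients of a product of power series in degrees at most `∑ i, h i` lie in an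
ideal, then so does a product of powers of the coefficients of the factors in degrees `h i`. -/
theorem prod_coeff_pow_mem {B : Type*} [CommRing B] (f : ι → PowerSeries B) (h : ι → ℕ)
    (J : Ideal B) (hJ : ∀ k ≤ ∑ i, h i, PowerSeries.coeff k (∏ i, f i) ∈ J) :
    ∏ i, PowerSeries.coeff (h i) (f i) ^ ((h i + 1) * (∑ j, h j - h i) + 1) ∈ J := by
  have hle := prod_toeplitzMinors_le (fun i k => PowerSeries.coeff k (f i)) h (∑ i, h i + 1)
    (Nat.lt_succ_self _) J fun k hk => by
      convert hJ k (by omega)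
      set I := Ideal.span {(PowerSeries.X : PowerSeries B) ^ (∑ i, h i + 1)} with hI
      have h1 : Ideal.Quotient.mk I (↑(∏ i, finPoly fun j : Fin (∑ i, h i + 1 + 1) =>
          PowerSeries.coeff (j : ℕ) (f i)) : PowerSeries B) = Ideal.Quotient.mk I (∏ i, f i) := by
        rw [← Polynomial.coeToPowerSeries.ringHom_apply, map_prod, map_prod, map_prod]
        refine Finset.prod_congr rfl fun i _ => ?_
        rw [Ideal.Quotient.eq, hI, Ideal.mem_span_singleton, PowerSeries.X_pow_dvd_iff]
        intro l hl
        rw [map_sub, Polynomial.coeToPowerSeries.ringHom_apply, Polynomial.coeff_coe,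
          coeff_finPoly, dif_pos (by omega), sub_self]
      rw [Ideal.Quotient.eq, hI, Ideal.mem_span_singleton, PowerSeries.X_pow_dvd_iff] at h1
      have h2 := h1 k hk
      rwa [map_sub, Polynomial.coeff_coe, sub_eq_zero] at h2
  refine hle (Ideal.prod_mem_prod fun i _ => ?_)
  have hi := Finset.single_le_sum (f := h) (fun _ _ => Nat.zero_le _) (Finset.mem_univ i)
  have := pow_mem_toeplitzMinors (fun k => PowerSeries.coeff k (f i)) (h i) (∑ j, h j - h i)
  convert this using 2 <;> omega

end Minors

section Polarization

theorem exists_sum_powerset_pow_eq_nsmul_prod {A : Type*} [CommRing A] {N : ℕ} (c : Fin N → A) :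
    ∃ M : ℕ, M ≠ 0 ∧
      ∑ S : Finset (Fin N), (-1) ^ Sᶜ.card * (∑ j ∈ S, c j) ^ N = M • ∏ j, c j := by
  classical
  refine ⟨(Finset.univ.filter fun f : Fin N → Fin N => Function.Surjective f).card,
    Finset.card_ne_zero_of_mem (a := id) (by simpa using Function.surjective_id), ?_⟩
  have h1 : ∀ S : Finset (Fin N), (-1) ^ Sᶜ.card * (∑ j ∈ S, c j) ^ N =
      ∑ f : Fin N → Fin N, (∏ k, c (f k)) *
        ∏ j ∈ Sᶜ, if j ∈ Set.range f then (0 : A) else -1 := by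
    intro S
    have h0 : ∑ j ∈ S, c j = ∑ j, if j ∈ S then c j else 0 := by simp
    have hpow : ∀ b : A, b ^ N = ∏ _k : Fin N, b := fun b => by simp
    rw [h0, hpow, Finset.prod_univ_sum, Fintype.piFinset_univ, Finset.mul_sum]
    refine Finset.sum_congr rfl fun f _ => ?_
    by_cases hf : ∀ k, f k ∈ S
    · rw [Finset.prod_congr rfl fun k _ => if_pos (hf k), mul_comm, ← Finset.prod_const]
      congr 1
      refine Finset.prod_congr rfl fun j hj => (if_neg ?_).symm
      rintro ⟨k, rfl⟩
      exact Finset.mem_compl.1 hj (hf k)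
    · obtain ⟨k, hk⟩ := not_forall.1 hf
      have h2 : ∏ j ∈ Sᶜ, (if j ∈ Set.range f then (0 : A) else -1) = 0 :=
        Finset.prod_eq_zero (Finset.mem_compl.2 hk) (if_pos (Set.mem_range_self k))
      rw [Finset.prod_eq_zero (Finset.mem_univ k) (if_neg hk), h2, mul_zero, mul_zero]
  rw [Finset.sum_congr rfl fun S _ => h1 S, Finset.sum_comm, ← Finset.sum_const,
    Finset.sum_filter]
  refine Finset.sum_congr rfl fun f _ => ?_
  have h2 := Finset.prod_add (fun _ : Fin N => (1 : A))
    (fun j => if j ∈ Set.range f then (0 : A) else -1) Finset.univ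
  simp only [Finset.prod_const_one, one_mul, Finset.powerset_univ, ← Finset.compl_eq_univ_sdiff]
    at h2
  rw [← Finset.mul_sum, ← h2]
  split_ifs with hf
  · have h3 : ∏ j, (1 + if j ∈ Set.range f then (0 : A) else -1) = 1 :=
      Finset.prod_eq_one fun j _ => by rw [if_pos (Set.mem_range.2 (hf j)), add_zero]
    rw [h3, mul_one]
    exact Function.Bijective.prod_comp ⟨Finite.injective_iff_surjective.2 hf, hf⟩ c
  · obtain ⟨j, hj⟩ := not_forall.1 hf
    have h3 : ∏ j, (1 + if j ∈ Set.range f then (0 : A) else -1) = 0 :=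
      Finset.prod_eq_zero (Finset.mem_univ j) (by rw [if_neg (mt Set.mem_range.1 hj), add_neg_cancel])
    rw [h3, mul_zero]

variable {A : Type*} [CommRing A]

theorem prod_mul_mem_of_sum_pow_mul_mem (K : Type*) [Field K] [CharZero K] [Algebra K A]
    (J : Ideal A) {N : ℕ} (c : Fin N → A) (y : A)
    (h : ∀ S : Finset (Fin N), (∑ j ∈ S, c j) ^ N * y ∈ J) : (∏ j, c j) * y ∈ J := by
  obtain ⟨M, hM, hs⟩ := exists_sum_powerset_pow_eq_nsmul_prod c
  have h1 : (M : A) * ((∏ j, c j) * y) ∈ J := by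
    rw [← mul_assoc, ← nsmul_eq_mul, ← hs, Finset.sum_mul]
    refine Ideal.sum_mem _ fun S _ => ?_
    rw [mul_assoc]
    exact Ideal.mul_mem_left _ _ (h S)
  have h2 := Ideal.mul_mem_left J (algebraMap K A (M : K)⁻¹) h1
  rwa [← mul_assoc, ← map_natCast (algebraMap K A), ← map_mul,
    inv_mul_cancel₀ (Nat.cast_ne_zero.2 hM), map_one, one_mul] at h2

theorem prod_prod_mem_of_prod_sum_pow_mem (K : Type*) [Field K] [CharZero K] [Algebra K A]
    {ι : Type*} [Fintype ι] [DecidableEq ι]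
    (J : Ideal A) {N : ℕ} (c : ι → Fin N → A)
    (h : ∀ S : ι → Finset (Fin N), ∏ i, (∑ j ∈ S i, c i j) ^ N ∈ J) : ∏ i, ∏ j, c i j ∈ J := by
  have key : ∀ (T : Finset ι) (S : ι → Finset (Fin N)),
      ∏ i, (if i ∈ T then ∏ j, c i j else (∑ j ∈ S i, c i j) ^ N) ∈ J := by
    intro T
    induction T using Finset.induction_on with
    | empty => simpa using h
    | insert s T hs ih =>
      intro S
      rw [← Finset.mul_prod_erase _ _ (Finset.mem_univ s), if_pos (Finset.mem_insert_self s T)]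
      refine prod_mul_mem_of_sum_pow_mul_mem K J _ _ fun S₀ => ?_
      have h1 := ih (Function.update S s S₀)
      rw [← Finset.mul_prod_erase _ _ (Finset.mem_univ s), if_neg hs, Function.update_self] at h1
      refine (congrArg (_ * · ∈ J) (Finset.prod_congr rfl fun i hi => ?_)).mpr h1
      have hi := Finset.ne_of_mem_erase hi
      simp [hi]
  simpa using key Finset.univ fun _ => ∅

end Polarization

section Taylor

variable {K A : Type*} [Field K] [CommRing A] [Algebra K A] (δ : Derivation K A A)

/-- The formal Taylor series `∑ δ^k(x) / k! t^k`. -/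
noncomputable def taylorSeries (x : A) : PowerSeries A :=
  PowerSeries.mk fun k => algebraMap K A (k.factorial : K)⁻¹ * (⇑δ)^[k] x

theorem taylorSeries_one : taylorSeries δ 1 = 1 := by
  ext k
  rcases k with _ | k
  · simp [taylorSeries]
  · simp [taylorSeries, PowerSeries.coeff_one, iterate_map_zero]

variable [CharZero K]

theorem coeff_succ_taylorSeries (x : A) (k : ℕ) :
    ((k : A) + 1) * PowerSeries.coeff (k + 1) (taylorSeries δ x) =
      PowerSeries.coeff k (taylorSeries δ (δ x)) := by
  have h : (k : A) + 1 = algebraMap K A ((k + 1 : ℕ) : K) := by simp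
  rw [taylorSeries, taylorSeries, PowerSeries.coeff_mk, PowerSeries.coeff_mk, ← mul_assoc, h,
    ← map_mul, Function.iterate_succ_apply, Nat.factorial_succ, Nat.cast_mul, mul_inv,
    mul_inv_cancel_left₀ (Nat.cast_ne_zero.2 k.succ_ne_zero)]

theorem derivative_taylorSeries (x : A) :
    PowerSeries.derivative A (taylorSeries δ x) = taylorSeries δ (δ x) := by
  ext k
  rw [PowerSeries.coeff_derivative, mul_comm, coeff_succ_taylorSeries]

theorem taylorSeries_mul (x y : A) :
    taylorSeries δ (x * y) = taylorSeries δ x * taylorSeries δ y := by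
  ext k
  induction k generalizing x y with
  | zero => simp [taylorSeries, PowerSeries.coeff_mul]
  | succ k ih =>
    have hadd : taylorSeries δ (δ (x * y)) = taylorSeries δ (x * δ y) + taylorSeries δ (y * δ x) := by
      ext l
      simp [taylorSeries, iterate_map_add, mul_add]
    have h : ((k : A) + 1) * PowerSeries.coeff (k + 1) (taylorSeries δ (x * y)) =
        ((k : A) + 1) * PowerSeries.coeff (k + 1) (taylorSeries δ x * taylorSeries δ y) := by
      rw [coeff_succ_taylorSeries, hadd, map_add, ih, ih, mul_comm _ (PowerSeries.coeff _ _),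
        ← PowerSeries.coeff_derivative, Derivation.leibniz, derivative_taylorSeries,
        derivative_taylorSeries, map_add, smul_eq_mul, smul_eq_mul]
    have h0 : IsUnit ((k : A) + 1) := by
      have := (Nat.cast_ne_zero (R := K).2 k.succ_ne_zero).isUnit.map (algebraMap K A)
      simpa using this
    exact h0.mul_left_cancel h

theorem taylorSeries_prod {ι : Type*} (s : Finset ι) (x : ι → A) :
    taylorSeries δ (∏ i ∈ s, x i) = ∏ i ∈ s, taylorSeries δ (x i) := by
  classical
  induction s using Finset.induction_on with
  | empty => simp [taylorSeries_one]
  | insert i s hi ih => rw [Finset.prod_insert hi, Finset.prod_insert hi, taylorSeries_mul, ih]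

theorem prod_prod_iterate_mem {ι : Type*} [Fintype ι] [DecidableEq ι] (h : ι → ℕ)
    (I : ι → Ideal A) {N : ℕ} (hN : ∀ i, (h i + 1) * (∑ j, h j - h i) + 1 ≤ N)
    (x : ι → Fin N → A) (hx : ∀ i j, x i j ∈ I i) (e : ι → Fin N → ℕ) (he : ∀ i j, e i j ≤ h i) :
    ∏ i, ∏ j, (⇑δ)^[e i j] (x i j) ∈
      Ideal.span {x | ∃ a ∈ ∏ i, I i, ∃ k ≤ ∑ j, h j, x = (⇑δ)^[k] a} := by
  set J := Ideal.span {x | ∃ a ∈ ∏ i, I i, ∃ k ≤ ∑ j, h j, x = (⇑δ)^[k] a} with hJ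
  have key : ∏ i, ∏ j, PowerSeries.coeff (e i j) (taylorSeries δ (x i j)) ∈ J := by
    refine prod_prod_mem_of_prod_sum_pow_mem K J _ fun S => ?_
    have h1 := prod_coeff_pow_mem
      (fun i => ∑ j ∈ S i, PowerSeries.X ^ (h i - e i j) * taylorSeries δ (x i j)) h J ?_
    · refine Ideal.mem_of_dvd _ (Finset.prod_dvd_prod_of_dvd _ _ fun i _ => ?_) h1
      refine dvd_trans (dvd_of_eq ?_) (pow_dvd_pow _ (hN i))
      congr 1
      rw [map_sum]
      refine Finset.sum_congr rfl fun j _ => ?_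
      rw [PowerSeries.coeff_X_pow_mul', if_pos (Nat.sub_le _ _), Nat.sub_sub_self (he i j)]
    · intro k hk
      rw [Finset.prod_univ_sum, map_sum]
      refine Ideal.sum_mem _ fun p _ => ?_
      rw [Finset.prod_mul_distrib, Finset.prod_pow_eq_pow_sum, ← taylorSeries_prod,
        PowerSeries.coeff_X_pow_mul']
      split_ifs with hle
      · rw [taylorSeries, PowerSeries.coeff_mk]
        exact Ideal.mul_mem_left _ _ (Ideal.subset_span
          ⟨_, Ideal.prod_mem_prod fun i _ => hx i (p i), _, (Nat.sub_le _ _).trans hk, rfl⟩)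
      · exact J.zero_mem
  have h2 := Ideal.mul_mem_left J (∏ i, ∏ j, algebraMap K A ((e i j).factorial : K)) key
  simp only [← Finset.prod_mul_distrib, taylorSeries, PowerSeries.coeff_mk, ← mul_assoc,
    ← map_mul, mul_inv_cancel₀ (Nat.cast_ne_zero (R := K).2 (Nat.factorial_ne_zero _)), map_one,
    one_mul] at h2
  exact h2

end Taylor

/-- Let `K` be a field of characteristic zero, `A` a commutative
`K`-algebra with a `K`-linear derivation `δ`, and for an ideal `I ⊆ A` and `h ∈ ℕ` let
`I^{(h)}` be the ideal generated by `{δ^k(a) : a ∈ I, 0 ≤ k ≤ h}`.  Then for any ideals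
`I_1,…,I_n` of `A` and `H = h_1 + ⋯ + h_n`,
`(I_1^{(h_1)} ⋯ I_n^{(h_n)})^{max_i (h_i+1)(H-h_i) + 1} ⊆ (I_1 ⋯ I_n)^{(H)}`. -/
theorem product_of_differential_ideals
    (K A : Type*) [Field K] [CharZero K] [CommRing A] [Algebra K A]
    (δ : Derivation K A A) (n : ℕ) (hn : 0 < n) (h : Fin n → ℕ)
    (I : Fin n → Ideal A) :
    (∏ i, Ideal.span {x | ∃ a ∈ I i, ∃ k ≤ h i, x = (⇑δ)^[k] a}) ^
        ((Finset.univ.sup fun i => (h i + 1) * (∑ j, h j - h i)) + 1) ≤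
      Ideal.span {x | ∃ a ∈ ∏ i, I i, ∃ k ≤ ∑ j, h j, x = (⇑δ)^[k] a} := by
  set N := (Finset.univ.sup fun i => (h i + 1) * (∑ j, h j - h i)) + 1 with hN
  have hpow : ∀ L : Ideal A, L ^ N = ∏ _j : Fin N, L := fun L => by simp
  rw [← Finset.prod_pow, Finset.prod_congr rfl fun i _ => hpow _]
  simp only [Ideal.prod_span]
  rw [Ideal.span_le]
  intro y hy
  obtain ⟨g, hg, rfl⟩ := (Set.mem_finsetProd _ _ _).1 hy
  have hg' : ∀ i, ∃ q : Fin N → A, (∀ j, ∃ a ∈ I i, ∃ k ≤ h i, q j = (⇑δ)^[k] a) ∧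
      ∏ j, q j = g i := fun i => by
    obtain ⟨q, hq, hqg⟩ := (Set.mem_finsetProd _ _ _).1 (hg (Finset.mem_univ i))
    exact ⟨q, fun j => hq (Finset.mem_univ j), hqg⟩
  choose q hq hqg using hg'
  choose x hx e he hqx using hq
  have := prod_prod_iterate_mem δ h I (N := N) (fun i => Nat.succ_le_succ
    (Finset.le_sup (f := fun i => (h i + 1) * (∑ j, h j - h i)) (Finset.mem_univ i))) x hx e he
  simp only [← hqg, hqx]
  exact this
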